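/- Let A_{-1}, A_0, A_1, G be as in the context, with G𝟙 = 𝟙, and let σ < 1 be a real number such that (A_{-1} − A_1)𝟙 ≥ (1 − σ)𝟙 entrywise. Then ‖A_0 + A_1 + A_1G‖ ≤ σ, ‖A_0‖ ≤ σ, ‖A_0 + A_1G‖ ≤ σ, and the operators I − A_0 and I − A_0 − A_1G are invertible in B(ℓ∞) with positive inverses. -/

import Mathlib

open BoundedContinuousFunction Filter

noncomputable section

/-- ℓ∞: the Banach space of bounded real sequences with the sup norm. -/
abbrev Linf : Type := BoundedContinuousFunction ℕ ℝ

/-- A sequence is nonnegative if all its entries are nonnegative. -/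
def vnonneg (x : Linf) : Prop := ∀ i, 0 ≤ x i

/-- An operator in B(ℓ∞) is positive if it maps nonnegative sequences to
nonnegative sequences. -/
def OpPos (A : Linf →L[ℝ] Linf) : Prop := ∀ x : Linf, vnonneg x → vnonneg (A x)

/-- The constant sequence with all entries equal to one. -/
def ones : Linf := BoundedContinuousFunction.const ℕ (1 : ℝ)

/-- The Neumann series of an operator of norm less than one converges pointwise to an inverse. -/
theorem exists_inverse_one_sub_hasSum {E : Type*} [NormedAddCommGroup E] [NormedSpace ℝ E]
    [CompleteSpace E] (A : E →L[ℝ] E) (h : ‖A‖ < 1) :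
    ∃ B : E →L[ℝ] E, (1 - A) * B = 1 ∧ B * (1 - A) = 1 ∧
      ∀ x, HasSum (fun n => (A ^ n) x) (B x) :=
  ⟨∑' n, A ^ n, mul_neg_geom_series A h, geom_series_mul_neg A h, fun x =>
    (ContinuousLinearMap.apply ℝ E x).hasSum (summable_geometric_of_norm_lt_one h).hasSum⟩

namespace OpPos

variable {A B : Linf →L[ℝ] Linf}

theorem add (hA : OpPos A) (hB : OpPos B) : OpPos (A + B) :=
  fun x hx i => add_nonneg (hA x hx i) (hB x hx i)

theorem mul (hA : OpPos A) (hB : OpPos B) : OpPos (A * B) :=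
  fun x hx => hA _ (hB x hx)

theorem pow (hA : OpPos A) (n : ℕ) : OpPos (A ^ n) := by
  induction n with
  | zero => exact fun x hx => by simpa using hx
  | succ n ih => rw [pow_succ]; exact ih.mul hA

theorem apply_ones_nonneg (hA : OpPos A) (i : ℕ) : 0 ≤ A ones i :=
  hA ones (fun _ => zero_le_one) i

/-- A positive operator attains its norm at the constant sequence `ones`. -/
theorem norm_le (hA : OpPos A) {c : ℝ} (h : ∀ i, A ones i ≤ c) : ‖A‖ ≤ c := by
  have hc : 0 ≤ c := (hA.apply_ones_nonneg 0).trans (h 0)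
  refine ContinuousLinearMap.opNorm_le_bound _ hc fun x => ?_
  refine (BoundedContinuousFunction.norm_le (by positivity)).2 fun i => ?_
  have hx (j : ℕ) : |x j| ≤ ‖x‖ := x.norm_coe_le_norm j
  have h₁ := hA (‖x‖ • ones - x) (fun j => by
    simpa [ones] using (abs_le.1 (hx j)).2) i
  have h₂ := hA (‖x‖ • ones + x) (fun j => by
    have := (abs_le.1 (hx j)).1
    simp [ones]; linarith) i
  simp only [map_sub, map_add, map_smul, BoundedContinuousFunction.coe_sub,
    BoundedContinuousFunction.coe_add, BoundedContinuousFunction.coe_smul, Pi.sub_apply,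
    Pi.add_apply, smul_eq_mul] at h₁ h₂
  have h₃ := mul_le_mul_of_nonneg_left (h i) (norm_nonneg x)
  rw [Real.norm_eq_abs, abs_le]
  constructor <;> linarith

/-- The Neumann series of a positive operator of norm less than one is a positive inverse. -/
theorem exists_inverse_one_sub (hA : OpPos A) (h : ‖A‖ < 1) :
    ∃ B : Linf →L[ℝ] Linf, (1 - A) * B = 1 ∧ B * (1 - A) = 1 ∧ OpPos B := by
  obtain ⟨B, hleft, hright, hB⟩ := exists_inverse_one_sub_hasSum A h
  refine ⟨B, hleft, hright, fun x hx i => ?_⟩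
  have hBxi : HasSum (fun n => (A ^ n) x i) (B x i) :=
    (BoundedContinuousFunction.evalCLM ℝ i).hasSum (hB x)
  exact hBxi.nonneg fun n => hA.pow n x hx i

end OpPos

/-- Norm bounds: ‖A₀ + A₁ + A₁G‖ ≤ σ, ‖A₀‖ ≤ σ, ‖A₀ + A₁G‖ ≤ σ, and both
I - A₀ and I - A₀ - A₁G are invertible with positive inverses. -/
theorem stmt10
    (Am1 A0 A1 G : Linf →L[ℝ] Linf)
    (hAm1 : OpPos Am1) (hA0 : OpPos A0) (hA1 : OpPos A1) (hG : OpPos G)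
    (hstoch : (Am1 + A0 + A1) ones = ones)
    (heq : A1 * G ^ 2 + A0 * G + Am1 = G)
    (hG1 : G ones = ones)
    (σ : ℝ) (hσ : σ < 1)
    (hgap : ∀ i, 1 - σ ≤ ((Am1 - A1) ones) i) :
    ‖A0 + A1 + A1 * G‖ ≤ σ ∧ ‖A0‖ ≤ σ ∧ ‖A0 + A1 * G‖ ≤ σ ∧
    (∃ B : Linf →L[ℝ] Linf, (1 - A0) * B = 1 ∧ B * (1 - A0) = 1 ∧ OpPos B) ∧
    (∃ C : Linf →L[ℝ] Linf,
      (1 - A0 - A1 * G) * C = 1 ∧ C * (1 - A0 - A1 * G) = 1 ∧ OpPos C) := by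
  have hA1G := hA1.mul hG
  have hone (i : ℕ) : Am1 ones i + A0 ones i + A1 ones i = 1 := DFunLike.congr_fun hstoch i
  have hgap' (i : ℕ) : 1 - σ ≤ Am1 ones i - A1 ones i := hgap i
  have hA1G_ones : (A1 * G) ones = A1 ones := congrArg A1 hG1
  have happ (i : ℕ) : A0 ones i + A1 ones i + A1 ones i ≤ σ := by
    linarith [hone i, hgap' i]
  have hsum : ‖A0 + A1 + A1 * G‖ ≤ σ := ((hA0.add hA1).add hA1G).norm_le fun i => by
    change A0 ones i + A1 ones i + (A1 * G) ones i ≤ σ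
    rw [hA1G_ones]
    exact happ i
  have hA0_norm : ‖A0‖ ≤ σ := hA0.norm_le fun i => by
    linarith [happ i, hA1.apply_ones_nonneg i]
  have hU_norm : ‖A0 + A1 * G‖ ≤ σ := (hA0.add hA1G).norm_le fun i => by
    change A0 ones i + (A1 * G) ones i ≤ σ
    rw [hA1G_ones]
    linarith [happ i, hA1.apply_ones_nonneg i]
  refine ⟨hsum, hA0_norm, hU_norm, hA0.exists_inverse_one_sub (hA0_norm.trans_lt hσ), ?_⟩
  have hU : 1 - A0 - A1 * G = 1 - (A0 + A1 * G) := by abel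
  rw [hU]
  exact (hA0.add hA1G).exists_inverse_one_sub (hU_norm.trans_lt hσ)
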